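/- arXiv:2604.19229 — 2 statements merged into one kernel-verified Lean document; each statement's English description precedes it below -/
import Mathlib

section
/- Let A ∈ ℝ^{2n×2n} be symmetric positive definite with symplectic eigenvalues 0 < d₁ ≤ … ≤ d_n, let 1 ≤ p ≤ n, and let β > d_p. Then the global minimum of f_β over ℝ^{2n×2p} is attained and equals ∑_{i=1}^{p} d_i − (1/(2β))∑_{i=1}^{p} d_i². -/
open Matrix BigOperators

noncomputable section

/-- The Poisson matrix `J_k = [[0, I],[-I, 0]]`, on index type `Fin k ⊕ Fin k`
(representing dimension `2k`). -/
def Jmat (k : ℕ) : Matrix (Fin k ⊕ Fin k) (Fin k ⊕ Fin k) ℝ :=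
  Matrix.fromBlocks 0 1 (-1) 0

/-- Squared Frobenius norm `‖M‖_F² = tr(Mᵀ M)`. -/
def frobSq {m k : Type*} [Fintype m] [Fintype k] (M : Matrix m k ℝ) : ℝ :=
  Matrix.trace (Mᵀ * M)

/-- The Frobenius norm. -/
def frobNorm {m k : Type*} [Fintype m] [Fintype k] (M : Matrix m k ℝ) : ℝ :=
  Real.sqrt (frobSq M)

/-- The trace-penalty function `f_β`. -/
def fPen (n p : ℕ) (A : Matrix (Fin n ⊕ Fin n) (Fin n ⊕ Fin n) ℝ) (β : ℝ)
    (X : Matrix (Fin n ⊕ Fin n) (Fin p ⊕ Fin p) ℝ) : ℝ :=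
  (1 / 2) * Matrix.trace (Xᵀ * A * X) + (β / 4) * frobSq (Xᵀ * Jmat n * X - Jmat p)

/-- The gradient `∇f_β(X) = AX - βJ_nX(XᵀJ_nX - J_p)`. -/
def gradPen (n p : ℕ) (A : Matrix (Fin n ⊕ Fin n) (Fin n ⊕ Fin n) ℝ) (β : ℝ)
    (X : Matrix (Fin n ⊕ Fin n) (Fin p ⊕ Fin p) ℝ) :
    Matrix (Fin n ⊕ Fin n) (Fin p ⊕ Fin p) ℝ :=
  A * X - β • (Jmat n * X * (Xᵀ * Jmat n * X - Jmat p))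

/-- The penalty function is invariant under orthogonal symplectic changes of the columns. -/
lemma fPen_mul_orthogonal {n p : ℕ} (A : Matrix (Fin n ⊕ Fin n) (Fin n ⊕ Fin n) ℝ) (β : ℝ)
    (X : Matrix (Fin n ⊕ Fin n) (Fin p ⊕ Fin p) ℝ)
    (Q : Matrix (Fin p ⊕ Fin p) (Fin p ⊕ Fin p) ℝ)
    (hQ : Q * Qᵀ = 1) (hJ : Qᵀ * Jmat p * Q = Jmat p) :
    fPen n p A β (X * Q) = fPen n p A β X := by
  have h1 : ((X * Q)ᵀ * A * (X * Q)).trace = (Xᵀ * A * X).trace := by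
    have : (X * Q)ᵀ * A * (X * Q) = Qᵀ * (Xᵀ * A * X * Q) := by
      simp only [Matrix.transpose_mul, Matrix.mul_assoc]
    rw [this, Matrix.trace_mul_comm, Matrix.mul_assoc, hQ, Matrix.mul_one]
  have h2 : (X * Q)ᵀ * Jmat n * (X * Q) - Jmat p = Qᵀ * (Xᵀ * Jmat n * X - Jmat p) * Q := by
    rw [Matrix.mul_sub, Matrix.sub_mul, hJ]
    simp only [Matrix.transpose_mul, Matrix.mul_assoc]
  have h3 : ∀ M : Matrix (Fin p ⊕ Fin p) (Fin p ⊕ Fin p) ℝ, frobSq (Qᵀ * M * Q) = frobSq M := by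
    intro M
    have : (Qᵀ * M * Q)ᵀ * (Qᵀ * M * Q) = Qᵀ * (Mᵀ * M * Q) := by
      calc (Qᵀ * M * Q)ᵀ * (Qᵀ * M * Q) = Qᵀ * (Mᵀ * (Q * Qᵀ) * M * Q) := by
            simp only [Matrix.transpose_mul, Matrix.transpose_transpose, Matrix.mul_assoc]
        _ = _ := by rw [hQ, Matrix.mul_one]
    rw [frobSq, this, Matrix.trace_mul_comm, Matrix.mul_assoc, hQ, Matrix.mul_one, frobSq]
  rw [fPen, h1, h2, h3, fPen]

/-- A symplectic substitution transforms the quadratic form by congruence. -/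
lemma fPen_symplectic_mul {n p : ℕ} {A S : Matrix (Fin n ⊕ Fin n) (Fin n ⊕ Fin n) ℝ} (β : ℝ)
    (hS : Sᵀ * Jmat n * S = Jmat n) (Z : Matrix (Fin n ⊕ Fin n) (Fin p ⊕ Fin p) ℝ) :
    fPen n p A β (S * Z) = fPen n p (Sᵀ * A * S) β Z := by
  have h : ∀ B : Matrix (Fin n ⊕ Fin n) (Fin n ⊕ Fin n) ℝ,
      (S * Z)ᵀ * B * (S * Z) = Zᵀ * (Sᵀ * B * S) * Z := by
    intro B
    simp only [Matrix.transpose_mul, Matrix.mul_assoc]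
  rw [fPen, h, h, hS, fPen]

lemma Jmat_mul_self (k : ℕ) : Jmat k * Jmat k = -1 := by
  simp [Jmat, Matrix.fromBlocks_multiply, ← Matrix.fromBlocks_one, Matrix.fromBlocks_neg]

lemma exists_eq_symplectic_mul {n : ℕ} {m : Type*} {S : Matrix (Fin n ⊕ Fin n) (Fin n ⊕ Fin n) ℝ}
    (hS : Sᵀ * Jmat n * S = Jmat n) (Y : Matrix (Fin n ⊕ Fin n) m ℝ) :
    ∃ Z : Matrix (Fin n ⊕ Fin n) m ℝ, S * Z = Y := by
  have h : (-(Jmat n * Sᵀ * Jmat n)) * S = 1 := by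
    rw [Matrix.neg_mul, Matrix.mul_assoc, Matrix.mul_assoc, ← Matrix.mul_assoc Sᵀ, hS,
      Jmat_mul_self, neg_neg]
  refine ⟨-(Jmat n * Sᵀ * Jmat n) * Y, ?_⟩
  rw [← Matrix.mul_assoc, mul_eq_one_comm.mp h, Matrix.one_mul]

lemma frobSq_eq_sum {m k : Type*} [Fintype m] [Fintype k] (M : Matrix m k ℝ) :
    frobSq M = ∑ j, ∑ i, M i j ^ 2 := by
  simp [frobSq, Matrix.trace, Matrix.mul_apply, pow_two]

lemma trace_transpose_mul_diagonal_mul {m k : Type*} [Fintype m] [DecidableEq m] [Fintype k]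
    (w : m → ℝ) (Z : Matrix m k ℝ) :
    (Zᵀ * Matrix.diagonal w * Z).trace = ∑ j, ∑ i, w i * Z i j ^ 2 := by
  simp only [Matrix.trace, Matrix.diag_apply, Matrix.mul_apply (N := Z), Matrix.mul_diagonal,
    Matrix.transpose_apply]
  exact Finset.sum_congr rfl fun j _ => Finset.sum_congr rfl fun i _ => by ring

lemma transpose_mul_Jmat_mul_apply {n : ℕ} {m : Type*}
    (Z : Matrix (Fin n ⊕ Fin n) m ℝ) (i j : m) :
    (Zᵀ * Jmat n * Z) i j =
      ∑ k, (Z (.inl k) i * Z (.inr k) j - Z (.inr k) i * Z (.inl k) j) := by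
  simp [Matrix.mul_apply, Jmat, Fintype.sum_sum_type, Matrix.one_apply, Finset.sum_add_distrib,
    sub_eq_neg_add]

/-- The lower bound for a diagonal quadratic form, when the component `(a + e) + i (b - c)` of
`Z = [[a, c], [b, e]]` is lower triangular. -/
lemma le_fPen_diagonal_of_triangular {n p : ℕ} (hpn : p ≤ n) {d : Fin n → ℝ} (hmono : Monotone d)
    (hdpos : ∀ i, 0 < d i) {β : ℝ} (hβ : 0 < β) (Z : Matrix (Fin n ⊕ Fin n) (Fin p ⊕ Fin p) ℝ)
    (hZ : ∀ (k : Fin n) (j : Fin p), (k : ℕ) < j →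
      Z (.inl k) (.inl j) + Z (.inr k) (.inr j) = 0 ∧
      Z (.inr k) (.inl j) - Z (.inl k) (.inr j) = 0) :
    (∑ i : Fin p, d (Fin.castLE hpn i)) - (1 / (2 * β)) * ∑ i : Fin p, (d (Fin.castLE hpn i))^2
      ≤ fPen n p (Matrix.diagonal (Sum.elim d d)) β Z := by
  set w : Fin p → ℝ := fun j => (Zᵀ * Jmat n * Z) (.inl j) (.inr j) with hw
  have hquad : ∑ j, d (Fin.castLE hpn j) * w j
      ≤ (1 / 2) * (Zᵀ * Matrix.diagonal (Sum.elim d d) * Z).trace := by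
    rw [trace_transpose_mul_diagonal_mul, Fintype.sum_sum_type, ← Finset.sum_add_distrib,
      Finset.mul_sum]
    refine Finset.sum_le_sum fun j _ => ?_
    simp only [hw, transpose_mul_Jmat_mul_apply, Fintype.sum_sum_type, Sum.elim_inl, Sum.elim_inr]
    rw [← Finset.sum_add_distrib, ← Finset.sum_add_distrib, ← Finset.sum_add_distrib,
      Finset.mul_sum, Finset.mul_sum]
    refine Finset.sum_le_sum fun k _ => ?_
    have hdk := hdpos k
    have hdj := hdpos (Fin.castLE hpn j)
    rcases lt_or_ge (k : ℕ) j with hkj | hkj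
    · obtain ⟨h1, h2⟩ := hZ k j hkj
      rw [eq_neg_of_add_eq_zero_right h1, sub_eq_zero.mp h2]
      nlinarith [mul_nonneg hdk.le (sq_nonneg (Z (.inl k) (.inl j))),
        mul_nonneg hdk.le (sq_nonneg (Z (.inl k) (.inr j))),
        mul_nonneg hdj.le (sq_nonneg (Z (.inl k) (.inl j))),
        mul_nonneg hdj.le (sq_nonneg (Z (.inl k) (.inr j)))]
    · have hle : d (Fin.castLE hpn j) ≤ d k := hmono (by simpa [Fin.le_def] using hkj)
      generalize Z (.inl k) (.inl j) = a
      generalize Z (.inr k) (.inr j) = e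
      generalize Z (.inl k) (.inr j) = c
      generalize Z (.inr k) (.inl j) = b
      have hs : 0 ≤ a ^ 2 + b ^ 2 + c ^ 2 + e ^ 2 := by positivity
      nlinarith [mul_nonneg (sub_nonneg.mpr hle) hs,
        mul_nonneg hdj.le (sq_nonneg (a - e)), mul_nonneg hdj.le (sq_nonneg (b + c))]
  have hpen : 2 * ∑ j, (w j - 1) ^ 2 ≤ frobSq (Zᵀ * Jmat n * Z - Jmat p) := by
    have hskew : ∀ j, (Zᵀ * Jmat n * Z) (.inr j) (.inl j) = -w j := by
      intro j
      simp only [hw, transpose_mul_Jmat_mul_apply, ← Finset.sum_neg_distrib]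
      exact Finset.sum_congr rfl fun k _ => by ring
    rw [frobSq_eq_sum, Fintype.sum_sum_type, ← Finset.sum_add_distrib, Finset.mul_sum]
    refine Finset.sum_le_sum fun j _ => ?_
    have h1 : ((Zᵀ * Jmat n * Z - Jmat p) (.inr j) (.inl j)) ^ 2 ≤
        ∑ i, ((Zᵀ * Jmat n * Z - Jmat p) i (.inl j)) ^ 2 :=
      Finset.single_le_sum (f := fun i => ((Zᵀ * Jmat n * Z - Jmat p) i (.inl j)) ^ 2)
        (fun i _ => sq_nonneg _) (Finset.mem_univ (Sum.inr j))
    have h2 : ((Zᵀ * Jmat n * Z - Jmat p) (.inl j) (.inr j)) ^ 2 ≤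
        ∑ i, ((Zᵀ * Jmat n * Z - Jmat p) i (.inr j)) ^ 2 :=
      Finset.single_le_sum (f := fun i => ((Zᵀ * Jmat n * Z - Jmat p) i (.inr j)) ^ 2)
        (fun i _ => sq_nonneg _) (Finset.mem_univ (Sum.inl j))
    have e1 : (Zᵀ * Jmat n * Z - Jmat p) (.inr j) (.inl j) = -(w j - 1) := by
      rw [Matrix.sub_apply, hskew]
      simp [Jmat]
      ring
    have e2 : (Zᵀ * Jmat n * Z - Jmat p) (.inl j) (.inr j) = w j - 1 := by
      rw [Matrix.sub_apply]
      simp [Jmat, hw]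
    rw [e1] at h1
    rw [e2] at h2
    linarith [neg_sq (w j - 1)]
  have hscalar : (∑ i : Fin p, d (Fin.castLE hpn i))
        - (1 / (2 * β)) * ∑ i : Fin p, (d (Fin.castLE hpn i))^2
      ≤ ∑ j, d (Fin.castLE hpn j) * w j + (β / 2) * ∑ j, (w j - 1) ^ 2 := by
    rw [Finset.mul_sum, Finset.mul_sum, ← Finset.sum_sub_distrib, ← Finset.sum_add_distrib]
    refine Finset.sum_le_sum fun j _ => ?_
    generalize d (Fin.castLE hpn j) = t
    have : t * w j + β / 2 * (w j - 1) ^ 2 - (t - 1 / (2 * β) * t ^ 2)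
        = β / 2 * (w j - 1 + t / β) ^ 2 := by
      field_simp
      ring
    have : 0 ≤ β / 2 * (w j - 1 + t / β) ^ 2 := by positivity
    linarith
  rw [fPen]
  nlinarith [mul_le_mul_of_nonneg_left hpen hβ.le]

/-- A complex matrix becomes lower triangular after right multiplication by a unitary matrix. -/
lemma exists_unitary_mul_triangular {n p : ℕ} (hpn : p ≤ n) (U : Matrix (Fin n) (Fin p) ℂ) :
    ∃ Q : Matrix (Fin p) (Fin p) ℂ, Qᴴ * Q = 1 ∧
      ∀ (k : Fin n) (j : Fin p), (k : ℕ) < j → (U * Q) k j = 0 := by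
  let f : Fin p → EuclideanSpace ℂ (Fin p) := fun k => WithLp.toLp 2 (U (Fin.castLE hpn k))
  let b := InnerProductSpace.gramSchmidtOrthonormalBasis (𝕜 := ℂ) (by simp) f
  refine ⟨Matrix.of fun m j => star (b j m), ?_, ?_⟩
  · ext i j
    have h := orthonormal_iff_ite.mp b.orthonormal j i
    rw [PiLp.inner_apply] at h
    simp only [Matrix.mul_apply, Matrix.conjTranspose_apply, Matrix.of_apply, star_star,
      Matrix.one_apply]
    simpa [eq_comm] using h
  · intro k j hkj
    have h := InnerProductSpace.gramSchmidtOrthonormalBasis_inv_triangular (𝕜 := ℂ)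
      (by simp) f (i := ⟨k, hkj.trans j.2⟩) (j := j) hkj
    rw [PiLp.inner_apply] at h
    simpa [Matrix.mul_apply, f] using h

/-- An orthogonal symplectic change of columns makes `(a + e) + i (b - c)` lower triangular,
where `Z = [[a, c], [b, e]]`. -/
lemma exists_orthogonal_symplectic_triangular {n p : ℕ} (hpn : p ≤ n)
    (Z : Matrix (Fin n ⊕ Fin n) (Fin p ⊕ Fin p) ℝ) :
    ∃ Q : Matrix (Fin p ⊕ Fin p) (Fin p ⊕ Fin p) ℝ, Q * Qᵀ = 1 ∧ Qᵀ * Jmat p * Q = Jmat p ∧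
      ∀ (k : Fin n) (j : Fin p), (k : ℕ) < j →
        (Z * Q) (.inl k) (.inl j) + (Z * Q) (.inr k) (.inr j) = 0 ∧
        (Z * Q) (.inr k) (.inl j) - (Z * Q) (.inl k) (.inr j) = 0 := by
  obtain ⟨Q, hQ, hU⟩ := exists_unitary_mul_triangular hpn (Matrix.of fun k j =>
    (⟨Z (.inl k) (.inl j) + Z (.inr k) (.inr j), Z (.inr k) (.inl j) - Z (.inl k) (.inr j)⟩ : ℂ))
  let R : Matrix (Fin p) (Fin p) ℝ := Q.map Complex.re
  let T : Matrix (Fin p) (Fin p) ℝ := Q.map Complex.im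
  have hre : Rᵀ * R + Tᵀ * T = 1 := by
    ext i j
    have h := congrArg Complex.re (congrFun (congrFun hQ i) j)
    have h1 : ((1 : Matrix (Fin p) (Fin p) ℂ) i j).re = (1 : Matrix (Fin p) (Fin p) ℝ) i j := by
      by_cases hij : i = j <;> simp [Matrix.one_apply, hij]
    rw [← h1, ← h]
    simp [R, T, Matrix.mul_apply, Finset.sum_add_distrib]
  have him : Rᵀ * T = Tᵀ * R := by
    ext i j
    have h := congrArg Complex.im (congrFun (congrFun hQ i) j)
    have h1 : ((1 : Matrix (Fin p) (Fin p) ℂ) i j).im = 0 := by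
      by_cases hij : i = j <;> simp [Matrix.one_apply, hij]
    rw [h1] at h
    simp only [Matrix.mul_apply, Matrix.conjTranspose_apply, Complex.im_sum, Complex.mul_im,
      Complex.star_def, Complex.conj_re, Complex.conj_im, neg_mul, ← sub_eq_add_neg,
      Finset.sum_sub_distrib] at h
    simp only [R, T, Matrix.mul_apply, Matrix.transpose_apply, Matrix.map_apply]
    linarith
  refine ⟨Matrix.fromBlocks R (-T) T R, mul_eq_one_comm.mp ?_, ?_, ?_⟩
  · rw [Matrix.fromBlocks_transpose, Matrix.fromBlocks_multiply, ← Matrix.fromBlocks_one]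
    simp only [Matrix.transpose_neg, Matrix.neg_mul, Matrix.mul_neg, neg_neg]
    rw [hre, him, add_comm (Tᵀ * T), hre, neg_add_cancel]
  · rw [Jmat, Matrix.fromBlocks_transpose, Matrix.fromBlocks_multiply, Matrix.fromBlocks_multiply]
    simp only [Matrix.transpose_neg, Matrix.neg_mul, Matrix.mul_neg, neg_neg, Matrix.mul_one,
      Matrix.mul_zero, zero_add, add_zero]
    rw [him, neg_add_cancel, add_comm (Tᵀ * T), hre, ← neg_add, hre, add_neg_cancel]
  · intro k j hkj
    have h := hU k j hkj
    have h1 := congrArg Complex.re h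
    have h2 := congrArg Complex.im h
    simp only [Matrix.mul_apply, Matrix.of_apply, Complex.re_sum, Complex.im_sum, Complex.mul_re,
      Complex.mul_im, Complex.zero_re, Complex.zero_im] at h1 h2
    simp only [Matrix.mul_apply, Fintype.sum_sum_type, Matrix.fromBlocks_apply₁₁,
      Matrix.fromBlocks_apply₁₂, Matrix.fromBlocks_apply₂₁, Matrix.fromBlocks_apply₂₂,
      Matrix.neg_apply, R, T, Matrix.map_apply, ← Finset.sum_add_distrib,
      ← Finset.sum_sub_distrib]
    constructor
    · rw [← h1]
      exact Finset.sum_congr rfl fun m _ => by ring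
    · rw [← h2]
      exact Finset.sum_congr rfl fun m _ => by ring

lemma exists_fPen_diagonal_eq {n p : ℕ} (hpn : p ≤ n) {d : Fin n → ℝ} {β : ℝ} (hβ : 0 < β)
    (hd : ∀ i : Fin p, d (Fin.castLE hpn i) ≤ β) :
    ∃ Z : Matrix (Fin n ⊕ Fin n) (Fin p ⊕ Fin p) ℝ,
      fPen n p (Matrix.diagonal (Sum.elim d d)) β Z =
        (∑ i : Fin p, d (Fin.castLE hpn i))
          - (1 / (2 * β)) * ∑ i : Fin p, (d (Fin.castLE hpn i))^2 := by
  let t : Fin p → ℝ := fun i => 1 - d (Fin.castLE hpn i) / β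
  have ht : ∀ i, 0 ≤ t i := fun i => sub_nonneg.mpr ((div_le_one hβ).mpr (hd i))
  let E : Matrix (Fin n) (Fin p) ℝ :=
    Matrix.of fun k i => if k = Fin.castLE hpn i then √(t i) else 0
  have hE : Eᵀ * E = Matrix.diagonal t := by
    ext i j
    by_cases hij : i = j
    · subst hij
      simp [E, Matrix.mul_apply, Real.mul_self_sqrt (ht i)]
    · simp [E, Matrix.mul_apply, hij, Ne.symm hij]
  have hsub : (Matrix.fromBlocks E 0 0 E)ᵀ * Jmat n * Matrix.fromBlocks E 0 0 E - Jmat p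
      = Matrix.fromBlocks 0 (Matrix.diagonal (fun i => t i - 1))
          (Matrix.diagonal (fun i => 1 - t i)) 0 := by
    rw [Jmat, Matrix.fromBlocks_transpose, Matrix.fromBlocks_multiply,
      Matrix.fromBlocks_multiply, Jmat, sub_eq_add_neg, Matrix.fromBlocks_neg,
      Matrix.fromBlocks_add]
    simp only [Matrix.transpose_zero, Matrix.mul_zero, Matrix.zero_mul, zero_add, add_zero,
      neg_zero, Matrix.mul_one, Matrix.mul_neg, Matrix.neg_mul, neg_neg, hE]
    simp only [← Matrix.diagonal_one, Matrix.diagonal_neg, Matrix.diagonal_add]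
    congr 2
    funext i
    ring
  refine ⟨Matrix.fromBlocks E 0 0 E, ?_⟩
  have hfrob : frobSq (Matrix.fromBlocks (0 : Matrix (Fin p) (Fin p) ℝ)
      (Matrix.diagonal (fun i => t i - 1)) (Matrix.diagonal (fun i => 1 - t i)) 0)
      = ∑ i, 2 * (t i - 1) ^ 2 := by
    rw [frobSq, Matrix.fromBlocks_transpose, Matrix.fromBlocks_multiply]
    simp only [Matrix.transpose_zero, Matrix.mul_zero, Matrix.zero_mul,
      Matrix.diagonal_transpose, Matrix.diagonal_mul_diagonal, zero_add, add_zero,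
      Matrix.trace, Fintype.sum_sum_type, Matrix.diag_apply, Matrix.fromBlocks_apply₁₁,
      Matrix.fromBlocks_apply₂₂, Matrix.diagonal_apply_eq, ← Finset.sum_add_distrib]
    exact Finset.sum_congr rfl fun i _ => by ring
  have htr : ((Matrix.fromBlocks E 0 0 E)ᵀ * Matrix.diagonal (Sum.elim d d) *
      Matrix.fromBlocks E 0 0 E).trace = ∑ i, 2 * (d (Fin.castLE hpn i) * t i) := by
    rw [trace_transpose_mul_diagonal_mul, Fintype.sum_sum_type, ← Finset.sum_add_distrib]
    refine Finset.sum_congr rfl fun i _ => ?_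
    simp [Fintype.sum_sum_type, E, ite_pow, Real.sq_sqrt (ht i)]
    ring
  rw [fPen, hsub, hfrob, htr, Finset.mul_sum, Finset.mul_sum, Finset.mul_sum,
    ← Finset.sum_add_distrib, ← Finset.sum_sub_distrib]
  refine Finset.sum_congr rfl fun i _ => ?_
  simp only [t]
  field_simp
  ring

theorem stmt14 (n p : ℕ) (hp : 1 ≤ p) (hpn : p ≤ n)
    (A : Matrix (Fin n ⊕ Fin n) (Fin n ⊕ Fin n) ℝ) (hA : A.PosDef)
    (d : Fin n → ℝ) (hmono : Monotone d) (hdpos : ∀ i, 0 < d i)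
    (S₀ : Matrix (Fin n ⊕ Fin n) (Fin n ⊕ Fin n) ℝ)
    (hS₀symp : S₀ᵀ * Jmat n * S₀ = Jmat n)
    (hS₀diag : S₀ᵀ * A * S₀ = Matrix.diagonal (Sum.elim d d))
    (β : ℝ) (hβ : d ⟨p - 1, by omega⟩ < β) :
    ∃ X : Matrix (Fin n ⊕ Fin n) (Fin p ⊕ Fin p) ℝ,
      (∀ Y, fPen n p A β X ≤ fPen n p A β Y) ∧
      fPen n p A β X =
        (∑ i : Fin p, d (Fin.castLE hpn i))
          - (1 / (2 * β)) * ∑ i : Fin p, (d (Fin.castLE hpn i))^2 := by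
  have hβ0 : 0 < β := (hdpos _).trans hβ
  have hd : ∀ i : Fin p, d (Fin.castLE hpn i) ≤ β := fun i =>
    (hmono (Fin.le_def.mpr (Nat.le_sub_one_of_lt i.2))).trans hβ.le
  obtain ⟨Z₀, hZ₀⟩ := exists_fPen_diagonal_eq hpn hβ0 hd
  have hval : fPen n p A β (S₀ * Z₀) = (∑ i : Fin p, d (Fin.castLE hpn i))
      - (1 / (2 * β)) * ∑ i : Fin p, (d (Fin.castLE hpn i))^2 := by
    rw [fPen_symplectic_mul β hS₀symp, hS₀diag, hZ₀]
  refine ⟨S₀ * Z₀, fun Y => ?_, hval⟩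
  obtain ⟨Z, rfl⟩ := exists_eq_symplectic_mul hS₀symp Y
  obtain ⟨Q, hQ, hQJ, htri⟩ := exists_orthogonal_symplectic_triangular hpn Z
  rw [hval, fPen_symplectic_mul β hS₀symp, hS₀diag, ← fPen_mul_orthogonal _ β Z Q hQ hQJ]
  exact le_fPen_diagonal_of_triangular hpn hmono hdpos hβ0 (Z * Q) htri
end
end

section
/- Let A ∈ ℝ^{2n×2n} be symmetric positive definite, and suppose S ∈ ℝ^{2n×2n} is symplectic (SᵀJ_nS = J_n) with SᵀAS = Diag(d₁,…,d_n,d₁,…,d_n) where d₁,…,d_n > 0. Then for every 1 ≤ i ≤ n, the 2n×2 matrix [S_i, S_{i+n}] formed by the i-th and (i+n)-th columns of S satisfies A[S_i, S_{i+n}] = d_i · J_n [S_i, S_{i+n}] J₁ᵀ. -/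
open Matrix BigOperators

noncomputable section

/-- The `2n × 2` matrix `[S_i, S_{i+n}]` formed by the `i`-th and `(i+n)`-th columns of `S`
(the two members of the `i`-th symplectic eigenvector pair). -/
def colPair (n : ℕ) (S : Matrix (Fin n ⊕ Fin n) (Fin n ⊕ Fin n) ℝ) (i : Fin n) :
    Matrix (Fin n ⊕ Fin n) (Fin 1 ⊕ Fin 1) ℝ :=
  Matrix.of fun r c =>
    Sum.elim (fun _ : Fin 1 => S r (Sum.inl i)) (fun _ : Fin 1 => S r (Sum.inr i)) c

theorem Jmat_mul_transpose (k : ℕ) : Jmat k * (Jmat k)ᵀ = 1 := by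
  simp [Jmat, Matrix.fromBlocks_transpose, Matrix.fromBlocks_multiply]

theorem colPair_eq_submatrix (n : ℕ) (S : Matrix (Fin n ⊕ Fin n) (Fin n ⊕ Fin n) ℝ)
    (i : Fin n) : colPair n S i = S.submatrix id (Sum.map (fun _ => i) (fun _ => i)) := by
  ext r c
  rcases c with c | c <;> rfl

theorem mul_colPair (n : ℕ) (M S : Matrix (Fin n ⊕ Fin n) (Fin n ⊕ Fin n) ℝ) (i : Fin n) :
    M * colPair n S i = colPair n (M * S) i := by
  simp only [colPair_eq_submatrix]
  rfl

theorem colPair_mul_Jmat_transpose (n : ℕ) (S : Matrix (Fin n ⊕ Fin n) (Fin n ⊕ Fin n) ℝ)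
    (i : Fin n) : colPair n S i * (Jmat 1)ᵀ = colPair n (S * (Jmat n)ᵀ) i := by
  ext r c
  rcases c with c | c <;>
    simp [colPair, Jmat, Matrix.mul_apply, Matrix.one_apply, Fin.eq_zero c]

theorem colPair_mul_diagonal (n : ℕ) (S : Matrix (Fin n ⊕ Fin n) (Fin n ⊕ Fin n) ℝ)
    (d : Fin n → ℝ) (i : Fin n) :
    colPair n (S * Matrix.diagonal (Sum.elim d d)) i = d i • colPair n S i := by
  ext r c
  rcases c with c | c <;> simp [colPair, mul_comm]

/-- A symplectic `S` satisfies `S⁻ᵀ = J S Jᵀ`. -/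
theorem Jmat_mul_mul_transpose_mul_transpose {n : ℕ}
    {S : Matrix (Fin n ⊕ Fin n) (Fin n ⊕ Fin n) ℝ} (hS : Sᵀ * Jmat n * S = Jmat n) :
    Jmat n * S * (Jmat n)ᵀ * Sᵀ = 1 := by
  rw [mul_eq_one_comm, ← Matrix.mul_assoc, ← Matrix.mul_assoc, hS, Jmat_mul_transpose]

theorem stmt19 (n : ℕ)
    (A S : Matrix (Fin n ⊕ Fin n) (Fin n ⊕ Fin n) ℝ) (hA : A.PosDef)
    (hSsymp : Sᵀ * Jmat n * S = Jmat n)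
    (d : Fin n → ℝ) (hdpos : ∀ i, 0 < d i)
    (hdiag : Sᵀ * A * S = Matrix.diagonal (Sum.elim d d)) :
    ∀ i : Fin n, A * colPair n S i = d i • (Jmat n * colPair n S i * (Jmat 1)ᵀ) := by
  intro i
  have hAS : A * S = Jmat n * S * (Jmat n)ᵀ * Matrix.diagonal (Sum.elim d d) := by
    rw [← hdiag, ← Matrix.mul_assoc, ← Matrix.mul_assoc,
      Jmat_mul_mul_transpose_mul_transpose hSsymp, Matrix.one_mul]
  rw [mul_colPair, hAS, colPair_mul_diagonal, mul_colPair, colPair_mul_Jmat_transpose]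
end
end
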